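/- There exists a type-1 configuration of [2,2,1] whose contact graph admits no proper 4-coloring. -/

import Mathlib

/-- A cuboid with integer root and integer dimensions. -/
structure Cuboid where
  root : ℤ × ℤ × ℤ
  dims : ℤ × ℤ × ℤ
deriving DecidableEq

namespace Cuboid

/-- The dimensions are positive. -/
def valid (C : Cuboid) : Prop :=
  0 < C.dims.1 ∧ 0 < C.dims.2.1 ∧ 0 < C.dims.2.2

/-- The closed cuboid `[x,x+a] × [y,y+b] × [z,z+c] ⊆ ℝ³`. -/
def toSet (C : Cuboid) : Set (ℝ × ℝ × ℝ) :=
  {p | (C.root.1 : ℝ) ≤ p.1 ∧ p.1 ≤ C.root.1 + C.dims.1 ∧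
       (C.root.2.1 : ℝ) ≤ p.2.1 ∧ p.2.1 ≤ C.root.2.1 + C.dims.2.1 ∧
       (C.root.2.2 : ℝ) ≤ p.2.2 ∧ p.2.2 ≤ C.root.2.2 + C.dims.2.2}

/-- The open cuboid `(x,x+a) × (y,y+b) × (z,z+c) ⊆ ℝ³` (the interior). -/
def inte (C : Cuboid) : Set (ℝ × ℝ × ℝ) :=
  {p | (C.root.1 : ℝ) < p.1 ∧ p.1 < C.root.1 + C.dims.1 ∧
       (C.root.2.1 : ℝ) < p.2.1 ∧ p.2.1 < C.root.2.1 + C.dims.2.1 ∧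
       (C.root.2.2 : ℝ) < p.2.2 ∧ p.2.2 < C.root.2.2 + C.dims.2.2}

/-- The set `(ℤ×ℤ×ℝ) ∪ (ℤ×ℝ×ℤ) ∪ (ℝ×ℤ×ℤ)` of grid lines. -/
def grid : Set (ℝ × ℝ × ℝ) :=
  {p | ((∃ m : ℤ, p.1 = m) ∧ (∃ n : ℤ, p.2.1 = n)) ∨
       ((∃ m : ℤ, p.1 = m) ∧ (∃ n : ℤ, p.2.2 = n)) ∨
       ((∃ m : ℤ, p.2.1 = m) ∧ (∃ n : ℤ, p.2.2 = n))}

/-- Two cuboids collide when their interiors intersect. -/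
def Collide (C D : Cuboid) : Prop := (C.inte ∩ D.inte).Nonempty

/-- Two cuboids touch when their interiors are disjoint but their intersection
contains a point outside the grid lines (i.e. it is a non-degenerate rectangle). -/
def Touch (C D : Cuboid) : Prop :=
  ¬ Collide C D ∧ ∃ p ∈ C.toSet ∩ D.toSet, p ∉ grid

end Cuboid

/-- A configuration: a finite family of valid pairwise non-colliding cuboids. -/
def IsConfig (F : Finset Cuboid) : Prop :=
  (∀ C ∈ F, C.valid) ∧ ∀ C ∈ F, ∀ D ∈ F, C ≠ D → ¬ Cuboid.Collide C D

/-- A type-1 configuration of `[a,b,c]`: every cuboid has dimensions exactly `(a,b,c)`. -/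
def Type1 (a b c : ℕ) (F : Finset Cuboid) : Prop :=
  ∀ C ∈ F, C.dims = ((a : ℤ), (b : ℤ), (c : ℤ))

/-- A type-2 configuration of `[a,b,c]`: every cuboid has dimensions `(a,b,c)` or `(b,a,c)`. -/
def Type2 (a b c : ℕ) (F : Finset Cuboid) : Prop :=
  ∀ C ∈ F, C.dims = ((a : ℤ), (b : ℤ), (c : ℤ)) ∨ C.dims = ((b : ℤ), (a : ℤ), (c : ℤ))

/-- A type-3 configuration of `[a,b,c]`: every cuboid's dimensions are a permutation of `(a,b,c)`. -/
def Type3 (a b c : ℕ) (F : Finset Cuboid) : Prop :=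
  ∀ C ∈ F, C.dims = ((a : ℤ), (b : ℤ), (c : ℤ)) ∨ C.dims = ((a : ℤ), (c : ℤ), (b : ℤ)) ∨
    C.dims = ((b : ℤ), (a : ℤ), (c : ℤ)) ∨ C.dims = ((b : ℤ), (c : ℤ), (a : ℤ)) ∨
    C.dims = ((c : ℤ), (a : ℤ), (b : ℤ)) ∨ C.dims = ((c : ℤ), (b : ℤ), (a : ℤ))

/-- A proper `k`-coloring of a configuration: touching cuboids get distinct colors. -/
def ProperColoring (k : ℕ) (F : Finset Cuboid) : Prop :=
  ∃ κ : Cuboid → Fin k, ∀ C ∈ F, ∀ D ∈ F, Cuboid.Touch C D → κ C ≠ κ D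

namespace Cuboid

/-- The cuboid of dimensions `(2,2,1)` rooted at `r`. -/
def brick (r : ℤ × ℤ × ℤ) : Cuboid := ⟨r, (2, 2, 1)⟩

/-- Bricks separated along a coordinate direction do not collide. -/
theorem not_collide_brick {r s : ℤ × ℤ × ℤ}
    (h : r.1 + 2 ≤ s.1 ∨ s.1 + 2 ≤ r.1 ∨ r.2.1 + 2 ≤ s.2.1 ∨ s.2.1 + 2 ≤ r.2.1 ∨
      r.2.2 + 1 ≤ s.2.2 ∨ s.2.2 + 1 ≤ r.2.2) :
    ¬ Collide (brick r) (brick s) := by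
  rintro ⟨p, ⟨h₁, h₂, h₃, h₄, h₅, h₆⟩, k₁, k₂, k₃, k₄, k₅, k₆⟩
  simp only [brick, Int.cast_ofNat, Int.cast_one] at *
  rcases h with h | h | h | h | h | h <;>
  · have h' := (Int.cast_le (R := ℝ)).2 h
    push_cast at h'
    linarith

theorem intCast_add_half_ne (m n : ℤ) : (m : ℝ) + 1 / 2 ≠ n := by
  intro h
  have h' : ((2 * m + 1 : ℤ) : ℝ) = ((2 * n : ℤ) : ℝ) := by
    push_cast
    linarith
  have := Int.cast_injective h'
  omega

/-- A brick touches a brick in the layer above it that overlaps it horizontally. -/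
theorem touch_brick_above {r s : ℤ × ℤ × ℤ} (hx : |s.1 - r.1| ≤ 1) (hy : |s.2.1 - r.2.1| ≤ 1)
    (hz : s.2.2 = r.2.2 + 1) : Touch (brick r) (brick s) := by
  obtain ⟨x, y, z⟩ := r
  obtain ⟨x', y', z'⟩ := s
  simp only [abs_le] at hx hy hz
  subst hz
  refine ⟨not_collide_brick (by simp), ⟨((max x x' : ℤ) + 1 / 2, (max y y' : ℤ) + 1 / 2,
    (z + 1 : ℤ)), ⟨?_, ?_⟩, ?_⟩⟩
  iterate 2
    have h₁ : max x x' ≤ x + 1 ∧ max x x' ≤ x' + 1 ∧ x ≤ max x x' ∧ x' ≤ max x x' := by omega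
    have h₂ : max y y' ≤ y + 1 ∧ max y y' ≤ y' + 1 ∧ y ≤ max y y' ∧ y' ≤ max y y' := by omega
    generalize max x x' = a at *
    generalize max y y' = b at *
    rify at h₁ h₂
    simp only [toSet, brick, Set.mem_ofPred_eq]
    push_cast
    refine ⟨?_, ?_, ?_, ?_, ?_, ?_⟩ <;> linarith
  · rintro (⟨⟨m, hm⟩, -⟩ | ⟨⟨m, hm⟩, -⟩ | ⟨⟨m, hm⟩, -⟩) <;> exact intCast_add_half_ne _ _ hm

/-- A brick touches a brick of the same layer that shares part of its face in direction `x`. -/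
theorem touch_brick_right {r s : ℤ × ℤ × ℤ} (hx : s.1 = r.1 + 2) (hy : |s.2.1 - r.2.1| ≤ 1)
    (hz : s.2.2 = r.2.2) : Touch (brick r) (brick s) := by
  obtain ⟨x, y, z⟩ := r
  obtain ⟨x', y', z'⟩ := s
  simp only [abs_le] at hx hy hz
  subst hx hz
  refine ⟨not_collide_brick (by simp), ⟨((x + 2 : ℤ), (max y y' : ℤ) + 1 / 2, z' + 1 / 2),
    ⟨?_, ?_⟩, ?_⟩⟩
  iterate 2
    have h₂ : max y y' ≤ y + 1 ∧ max y y' ≤ y' + 1 ∧ y ≤ max y y' ∧ y' ≤ max y y' := by omega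
    generalize max y y' = b at *
    rify at h₂
    simp only [toSet, brick, Set.mem_ofPred_eq]
    push_cast
    refine ⟨?_, ?_, ?_, ?_, ?_, ?_⟩ <;> linarith
  · rintro (⟨-, ⟨m, hm⟩⟩ | ⟨-, ⟨m, hm⟩⟩ | ⟨⟨m, hm⟩, -⟩) <;> exact intCast_add_half_ne _ _ hm

/-- A brick touches a brick of the same layer that shares part of its face in direction `y`. -/
theorem touch_brick_behind {r s : ℤ × ℤ × ℤ} (hx : |s.1 - r.1| ≤ 1) (hy : s.2.1 = r.2.1 + 2)
    (hz : s.2.2 = r.2.2) : Touch (brick r) (brick s) := by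
  obtain ⟨x, y, z⟩ := r
  obtain ⟨x', y', z'⟩ := s
  simp only [abs_le] at hx hy hz
  subst hy hz
  refine ⟨not_collide_brick (by simp), ⟨((max x x' : ℤ) + 1 / 2, (y + 2 : ℤ), z' + 1 / 2),
    ⟨?_, ?_⟩, ?_⟩⟩
  iterate 2
    have h₂ : max x x' ≤ x + 1 ∧ max x x' ≤ x' + 1 ∧ x ≤ max x x' ∧ x' ≤ max x x' := by omega
    generalize max x x' = b at *
    rify at h₂
    simp only [toSet, brick, Set.mem_ofPred_eq]
    push_cast
    refine ⟨?_, ?_, ?_, ?_, ?_, ?_⟩ <;> linarith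
  · rintro (⟨⟨m, hm⟩, -⟩ | ⟨⟨m, hm⟩, -⟩ | ⟨-, ⟨m, hm⟩⟩) <;> exact intCast_add_half_ne _ _ hm

theorem Touch.symm {C D : Cuboid} (h : Touch C D) : Touch D C := by
  simpa only [Touch, Collide, Set.inter_comm] using h

/-- A decidable sufficient condition for the bricks rooted at `r` and `s` to touch. -/
theorem touch_brick {r s : ℤ × ℤ × ℤ}
    (h : |s.1 - r.1| ≤ 1 ∧ |s.2.1 - r.2.1| ≤ 1 ∧ (s.2.2 = r.2.2 + 1 ∨ r.2.2 = s.2.2 + 1) ∨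
      (s.1 = r.1 + 2 ∨ r.1 = s.1 + 2) ∧ |s.2.1 - r.2.1| ≤ 1 ∧ s.2.2 = r.2.2 ∨
      |s.1 - r.1| ≤ 1 ∧ (s.2.1 = r.2.1 + 2 ∨ r.2.1 = s.2.1 + 2) ∧ s.2.2 = r.2.2) :
    Touch (brick r) (brick s) := by
  rcases h with ⟨hx, hy, hz | hz⟩ | ⟨hx | hx, hy, hz⟩ | ⟨hx, hy | hy, hz⟩
  · exact touch_brick_above hx hy hz
  · exact (touch_brick_above (abs_sub_comm s.1 _ ▸ hx) (abs_sub_comm s.2.1 _ ▸ hy) hz).symm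
  · exact touch_brick_right hx hy hz
  · exact (touch_brick_right hx (abs_sub_comm s.2.1 _ ▸ hy) hz.symm).symm
  · exact touch_brick_behind hx hy hz
  · exact (touch_brick_behind (abs_sub_comm s.1 _ ▸ hx) hy hz.symm).symm

/-- The roots of eleven bricks that cannot be properly colored with four colors. -/
def roots : Finset (ℤ × ℤ × ℤ) :=
  {(1, 2, 1), (3, 2, 1), (2, 3, 2), (2, 1, 2), (2, 0, 1), (2, 1, 0), (1, 3, 0), (3, 3, 0),
    (3, 4, 1), (1, 4, 1), (2, 5, 0)}

set_option synthInstance.maxSize 2000 in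
/-- The contact graph of the bricks rooted at `roots` is not 4-colorable. -/
theorem contact_roots_not_colorable (a b : Fin 4) (_ : b ≠ a) (c : Fin 4) (_ : c ≠ a ∧ c ≠ b)
    (d : Fin 4) (_ : d ≠ a ∧ d ≠ b ∧ d ≠ c) (e : Fin 4) (_ : e ≠ a ∧ e ≠ b ∧ e ≠ d)
    (f : Fin 4) (_ : f ≠ a ∧ f ≠ b ∧ f ≠ e) (g : Fin 4) (_ : g ≠ a ∧ g ≠ f)
    (h : Fin 4) (_ : h ≠ b ∧ h ≠ f ∧ h ≠ g) (i : Fin 4) (_ : i ≠ b ∧ i ≠ c ∧ i ≠ h)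
    (j : Fin 4) (_ : j ≠ a ∧ j ≠ c ∧ j ≠ g ∧ j ≠ i) (k : Fin 4) :
    ¬ (k ≠ g ∧ k ≠ h ∧ k ≠ i ∧ k ≠ j) := by
  decide +revert

end Cuboid

/-- There is a type-1 configuration of `[2,2,1]` with no proper 4-coloring. -/
theorem exists_type1_221_not_4colorable :
    ∃ F : Finset Cuboid, IsConfig F ∧ Type1 2 2 1 F ∧ ¬ ProperColoring 4 F := by
  refine ⟨Cuboid.roots.image Cuboid.brick, ⟨?_, ?_⟩, ?_, ?_⟩
  · simp only [Finset.forall_mem_image]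
    exact fun _ _ => by simp [Cuboid.brick, Cuboid.valid]
  · simp only [Finset.forall_mem_image]
    intro r hr s hs hne
    have key : ∀ r ∈ Cuboid.roots, ∀ s ∈ Cuboid.roots, r ≠ s →
        r.1 + 2 ≤ s.1 ∨ s.1 + 2 ≤ r.1 ∨ r.2.1 + 2 ≤ s.2.1 ∨ s.2.1 + 2 ≤ r.2.1 ∨
          r.2.2 + 1 ≤ s.2.2 ∨ s.2.2 + 1 ≤ r.2.2 := by
      decide
    exact Cuboid.not_collide_brick (key r hr s hs fun h => hne (h ▸ rfl))
  · simp only [Type1, Finset.forall_mem_image]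
    exact fun _ _ => rfl
  · rintro ⟨κ, hκ⟩
    simp only [Finset.forall_mem_image] at hκ
    have hne : ∀ r ∈ Cuboid.roots, ∀ s ∈ Cuboid.roots, _ → _ :=
      fun r hr s hs h => hκ hr hs (Cuboid.touch_brick h)
    refine Cuboid.contact_roots_not_colorable
      (κ (.brick (1, 2, 1))) (κ (.brick (3, 2, 1))) ?_ (κ (.brick (2, 3, 2))) ?_
      (κ (.brick (2, 1, 2))) ?_ (κ (.brick (2, 0, 1))) ?_ (κ (.brick (2, 1, 0))) ?_
      (κ (.brick (1, 3, 0))) ?_ (κ (.brick (3, 3, 0))) ?_ (κ (.brick (3, 4, 1))) ?_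
      (κ (.brick (1, 4, 1))) ?_ (κ (.brick (2, 5, 0))) ?_ <;>
    repeat' first | apply And.intro | exact hne _ (by decide) _ (by decide) (by decide)
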